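/- Let w ∈ A_∞ be a Muckenhoupt weight on ℝ^n. Then there exist constants C_{w,n}, c_{w,n} > 0, depending only on w and n, such that the sharp Tauberian constant of the uncentered maximal operator M_w defined with respect to the measure w dx satisfies C_w(α) − 1 ≤ C_{w,n} (1 − α)^{c_{w,n}} for all α sufficiently close to 1. -/

import Mathlib

open MeasureTheory Metric Set
open scoped ENNReal

/-- The measure `w dx` associated to a weight `w` on ℝⁿ. -/
noncomputable def weightMeasure (n : ℕ) (w : (Fin n → ℝ) → ℝ≥0∞) : Measure (Fin n → ℝ) :=
  MeasureTheory.volume.withDensity w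

/-- The uncentered Hardy–Littlewood maximal operator over axis-parallel cubes
(closed balls in the sup metric), with respect to Lebesgue measure. -/
noncomputable def maxOp (n : ℕ) (f : (Fin n → ℝ) → ℝ≥0∞) (x : Fin n → ℝ) : ℝ≥0∞ :=
  ⨆ (c : Fin n → ℝ) (r : ℝ) (_ : 0 < r) (_ : x ∈ closedBall c r),
    (∫⁻ y in closedBall c r, f y) / volume (closedBall c r)

section

open scoped NNReal Topology

theorem exists_closedBall_subset_closedBall_of_mem {E : Type*} [NormedAddCommGroup E]
    [NormedSpace ℝ E] {c x : E} {R ρ : ℝ} (hR : 0 < R) (hρ : 0 ≤ ρ) (hρR : ρ ≤ R)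
    (hx : x ∈ closedBall c R) :
    ∃ z, dist z x ≤ ρ ∧ closedBall z ρ ⊆ closedBall c R := by
  have hx' : dist x c ≤ R := hx
  have h0 : 0 ≤ ρ / R := by positivity
  have h1 : ρ / R ≤ 1 := (div_le_one hR).2 hρR
  refine ⟨AffineMap.lineMap x c (ρ / R), ?_, closedBall_subset_closedBall' ?_⟩
  · rw [dist_lineMap_left, Real.norm_of_nonneg h0]
    calc ρ / R * dist x c ≤ ρ / R * R := by gcongr
      _ = ρ := by field_simp
  · rw [dist_lineMap_right, Real.norm_of_nonneg (by linarith)]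
    calc ρ + (1 - ρ / R) * dist x c ≤ ρ + (1 - ρ / R) * R := by
          gcongr
      _ = R := by field_simp; ring

section Halo

variable {E : Type*} [NormedAddCommGroup E]

/-- The union of a family of closed balls, given by pairs of a centre and a radius. -/
def ballUnion (J : Set (E × ℝ)) : Set E := ⋃ p ∈ J, closedBall p.1 p.2

theorem closedBall_subset_ballUnion {J : Set (E × ℝ)} {p : E × ℝ} (hp : p ∈ J) :
    closedBall p.1 p.2 ⊆ ballUnion J :=
  subset_biUnion_of_mem (u := fun p : E × ℝ => closedBall p.1 p.2) hp

/-- The points that, relative to the radius of some ball of the family `J`, are `t`-close both to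
that ball and to the complement of the union of the family. -/
def ballHalo (J : Set (E × ℝ)) (t : ℝ) : Set E :=
  {x | ∃ p ∈ J, ∃ q ∈ closedBall p.1 p.2, ∃ v ∉ ballUnion J,
    dist x q ≤ t * p.2 ∧ dist x v ≤ t * p.2}

/-- The points at distance about `8 ^ m` from the complement of `U`. -/
def distLayer (U : Set E) (m : ℤ) : Set E :=
  {x | (8 : ℝ) ^ m / 2 ≤ infDist x Uᶜ ∧ infDist x Uᶜ < 4 * 8 ^ m}

theorem measurableSet_distLayer [MeasurableSpace E] [BorelSpace E] (U : Set E) (m : ℤ) :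
    MeasurableSet (distLayer U m) :=
  (measurableSet_le measurable_const measurable_infDist).inter
    (measurableSet_lt measurable_infDist measurable_const)

theorem pairwise_disjoint_distLayer (U : Set E) :
    Pairwise (Function.onFun Disjoint (distLayer U)) := by
  have key : ∀ m k : ℤ, m < k → Disjoint (distLayer U m) (distLayer U k) := by
    intro m k hmk
    refine Set.disjoint_left.2 fun x hx hx' => ?_
    have h1 : (8 : ℝ) ^ (m + 1) ≤ 8 ^ k := zpow_le_zpow_right₀ (by norm_num) (by omega)
    rw [zpow_add₀ (by norm_num), zpow_one] at h1
    linarith [hx.2, hx'.1]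
  intro m k hmk
  rcases lt_or_gt_of_ne hmk with h | h
  · exact key m k h
  · exact (key k m h).symm

variable [NormedSpace ℝ E]

/-- A point of the halo lies, at every intermediate scale, near a ball inside the corresponding
distance layer. -/
theorem mem_thickening_of_mem_ballHalo {J : Set (E × ℝ)} {t s : ℝ}
    (ht1 : t ≤ 1) {x q v : E} {p : E × ℝ} (hp : p ∈ J) (hp0 : 0 < p.2)
    (hq : q ∈ closedBall p.1 p.2) (hv : v ∉ ballUnion J) (hxq : dist x q ≤ s * p.2)
    (hxv : dist x v ≤ s * p.2) {m : ℤ} (h1 : s * p.2 ≤ 8 ^ m) (h2 : (8 : ℝ) ^ m ≤ t * p.2 / 4) :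
    x ∈ thickening (3 * 8 ^ m) {z | closedBall z (8 ^ m / 2) ⊆
      distLayer (ballUnion J) m ∩ (ballHalo J t ∩ ballUnion J)} := by
  have hρ : (0 : ℝ) < 8 ^ m := by positivity
  set ρ : ℝ := 8 ^ m with hρdef
  have hρR : ρ ≤ p.2 := by nlinarith
  obtain ⟨z, hzq, hz⟩ := exists_closedBall_subset_closedBall_of_mem hp0 hρ.le hρR hq
  have hzU : closedBall z ρ ⊆ ballUnion J := hz.trans (closedBall_subset_ballUnion hp)
  have hxz : dist x z ≤ 2 * ρ := by
    have := dist_triangle x q z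
    rw [dist_comm q z] at this
    linarith
  refine mem_thickening_iff.2 ⟨z, fun y hy => ?_, by linarith⟩
  have hyz : dist y z ≤ ρ / 2 := hy
  have hyv : dist y v ≤ 7 / 2 * ρ := by
    have h3 := dist_triangle y z v
    have h4 := dist_triangle z x v
    rw [dist_comm z x] at h4
    linarith
  have hyQ : y ∈ closedBall z ρ := closedBall_subset_closedBall (by linarith) hy
  refine ⟨⟨?_, ?_⟩, ⟨p, hp, y, hz hyQ, v, hv, ?_, ?_⟩, hzU hyQ⟩
  · refine (le_infDist ⟨v, hv⟩).2 fun b hb => ?_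
    have hb' : ρ < dist b z := by
      by_contra! h
      exact hb (hzU h)
    have := dist_triangle b y z
    rw [dist_comm b y] at this
    linarith
  · exact (infDist_le_dist_of_mem hv).trans_lt (by linarith)
  · rw [dist_self]
    linarith
  · linarith

end Halo

section Doubling

variable {E : Type*} [NormedAddCommGroup E] [MeasurableSpace E] {μ : Measure E} {D : ℝ≥0}

theorem measure_closedBall_two_pow_mul_le
    (hD : ∀ z r, 0 < r → μ (closedBall z (2 * r)) ≤ D * μ (closedBall z r))
    (z : E) {r : ℝ} (hr : 0 < r) (k : ℕ) :
    μ (closedBall z (2 ^ k * r)) ≤ D ^ k * μ (closedBall z r) := by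
  induction k with
  | zero => simp
  | succ k ih =>
    calc μ (closedBall z (2 ^ (k + 1) * r)) = μ (closedBall z (2 * (2 ^ k * r))) := by ring_nf
      _ ≤ D * μ (closedBall z (2 ^ k * r)) := hD _ _ (by positivity)
      _ ≤ D * (D ^ k * μ (closedBall z r)) := by gcongr
      _ = D ^ (k + 1) * μ (closedBall z r) := by ring

theorem exists_closedBall_measure_ge [NormedSpace ℝ E]
    (hD : ∀ z r, 0 < r → μ (closedBall z (2 * r)) ≤ D * μ (closedBall z r))
    (N k : ℕ) {c x : E} {r : ℝ} (hr : 0 < r) (hx : x ∈ closedBall c r) :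
    ∃ z, dist z x ≤ (4 * 8 ^ N : ℝ)⁻¹ ^ k * r ∧
      closedBall z ((4 * 8 ^ N : ℝ)⁻¹ ^ k * r) ⊆ closedBall c r ∧
      μ (closedBall c r) ≤
        (D ^ (3 * N + 2)) ^ (k + 1) * μ (closedBall z ((4 * 8 ^ N : ℝ)⁻¹ ^ k * r)) := by
  have hK : (4 * 8 ^ N : ℝ) = 2 ^ (3 * N + 2) := by
    rw [pow_add, pow_mul]
    norm_num
    ring
  have hK2 : (2 : ℝ) ≤ 4 * 8 ^ N := by
    have : (1 : ℝ) ≤ 8 ^ N := one_le_pow₀ (by norm_num)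
    linarith
  have hle1 : (4 * 8 ^ N : ℝ)⁻¹ ^ k ≤ 1 :=
    pow_le_one₀ (by positivity) (inv_le_one_of_one_le₀ (by linarith))
  obtain ⟨z, hzx, hz⟩ := exists_closedBall_subset_closedBall_of_mem hr
    (show 0 ≤ (4 * 8 ^ N : ℝ)⁻¹ ^ k * r by positivity) (by nlinarith) hx
  refine ⟨z, hzx, hz, ?_⟩
  have hzc : dist z c ≤ r := hz (mem_closedBall_self (by positivity))
  calc μ (closedBall c r)
      ≤ μ (closedBall z (2 ^ ((3 * N + 2) * (k + 1)) * ((4 * 8 ^ N : ℝ)⁻¹ ^ k * r))) := by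
        refine measure_mono (closedBall_subset_closedBall' ?_)
        have : (2 : ℝ) ^ ((3 * N + 2) * (k + 1)) * ((4 * 8 ^ N : ℝ)⁻¹ ^ k * r) =
            4 * 8 ^ N * r := by
          rw [pow_mul, ← hK, pow_succ, inv_pow]
          field_simp
        rw [this, dist_comm]
        nlinarith
    _ ≤ D ^ ((3 * N + 2) * (k + 1)) * μ (closedBall z ((4 * 8 ^ N : ℝ)⁻¹ ^ k * r)) :=
        measure_closedBall_two_pow_mul_le hD z (by positivity) _
    _ = _ := by rw [pow_mul]

variable [BorelSpace E]

/-- Greedy selection, in order of decreasing radius, of a subfamily with small overlap whose union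
nearly contains the original balls. -/
theorem exists_subfamily_small_overlap {δ : ℝ≥0∞} {ε : ℝ} (hε : 0 ≤ ε)
    (hsmall : ∀ (c x : E) (r : ℝ), 0 < r → x ∈ closedBall c r → ∃ z, dist z x ≤ ε * r ∧
      closedBall z (ε * r) ⊆ closedBall c r ∧
      δ * μ (closedBall c r) ≤ μ (closedBall z (ε * r)))
    (J : Finset (E × ℝ)) (hJ : ∀ p ∈ J, 0 < p.2) :
    ∃ S ⊆ J, δ * ∑ p ∈ S, μ (closedBall p.1 p.2) ≤ μ (ballUnion S) ∧
      ∀ p ∈ J, ∀ x ∈ closedBall p.1 p.2, ∃ i ∈ S, ∃ q ∈ closedBall i.1 i.2,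
        dist x q ≤ 2 * ε * i.2 := by
  classical
  induction J using Finset.induction_on_min_value (fun p : E × ℝ => p.2) with
  | empty => exact ⟨∅, by simp⟩
  | insert a J ha hmin ih =>
    obtain ⟨S, hSJ, hsum, hcov⟩ := ih fun p hp => hJ p (Finset.mem_insert_of_mem hp)
    have ha0 := hJ a (Finset.mem_insert_self a J)
    by_cases hsel : δ * μ (closedBall a.1 a.2) ≤
        μ (closedBall a.1 a.2 \ ballUnion (S : Set (E × ℝ)))
    · refine ⟨insert a S, Finset.insert_subset_insert a hSJ, ?_, fun p hp x hx => ?_⟩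
      · have hmeas : MeasurableSet (ballUnion (S : Set (E × ℝ))) :=
          Finset.measurableSet_biUnion S fun p _ => measurableSet_closedBall
        have hU : ballUnion ((insert a S : Finset (E × ℝ)) : Set (E × ℝ)) =
            ballUnion (S : Set (E × ℝ)) ∪ closedBall a.1 a.2 := by
          simp [ballUnion, union_comm]
        rw [Finset.sum_insert fun h => ha (hSJ h), mul_add, hU,
          ← measure_add_sdiff hmeas.nullMeasurableSet, add_comm]
        gcongr
      · rcases Finset.mem_insert.1 hp with rfl | hp
        · exact ⟨p, Finset.mem_insert_self _ _, x, hx, by rw [dist_self]; positivity⟩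
        · obtain ⟨i, hi, h⟩ := hcov p hp x hx
          exact ⟨i, Finset.mem_insert_of_mem hi, h⟩
    · refine ⟨S, hSJ.trans (Finset.subset_insert a J), hsum, fun p hp x hx => ?_⟩
      rcases Finset.mem_insert.1 hp with rfl | hp
      · obtain ⟨z, hzx, hzsub, hz⟩ := hsmall p.1 x p.2 ha0 hx
        have hnot : ¬ closedBall z (ε * p.2) ⊆
            closedBall p.1 p.2 \ ballUnion (S : Set (E × ℝ)) := fun h =>
          hsel (hz.trans (measure_mono h))
        obtain ⟨q, hq, hq'⟩ := not_subset.1 hnot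
        have hqU : q ∈ ballUnion (S : Set (E × ℝ)) := by
          by_contra h
          exact hq' ⟨hzsub hq, h⟩
        obtain ⟨i, hi, hqi⟩ := mem_iUnion₂.1 hqU
        refine ⟨i, hi, q, hqi, ?_⟩
        have h1 : dist q z ≤ ε * p.2 := hq
        have h2 : ε * p.2 ≤ ε * i.2 := by
          gcongr
          exact hmin i (hSJ hi)
        have h3 := dist_triangle x z q
        rw [dist_comm x z, dist_comm z q] at h3
        linarith
      · exact hcov p hp x hx

/-- The union of the balls of density greater than `α` is covered by the open balls of such
density. -/
theorem exists_mem_ball_of_mem_closedBall [NormedSpace ℝ E]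
    (hfin : ∀ z r, 0 < r → μ (closedBall z r) < ⊤)
    {A : Set E} {α : ℝ} {c x : E} {r : ℝ} (hr : 0 < r) (hx : x ∈ closedBall c r)
    (h : ENNReal.ofReal α * μ (closedBall c r) < μ (closedBall c r ∩ A)) :
    ∃ r', 0 < r' ∧ x ∈ ball c r' ∧
      ENNReal.ofReal α * μ (closedBall c r') < μ (closedBall c r' ∩ A) := by
  have hlim := tendsto_measure_cthickening_of_isClosed (μ := μ) (s := closedBall c r)
    ⟨1, one_pos, by
      rw [cthickening_closedBall zero_le_one hr.le]
      exact (hfin _ _ (by positivity)).ne⟩ isClosed_closedBall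
  have hlim' := ENNReal.Tendsto.const_mul (a := ENNReal.ofReal α) hlim
    (Or.inr ENNReal.ofReal_ne_top)
  have hev : ∀ᶠ s in 𝓝[>] (0 : ℝ), ENNReal.ofReal α * μ (cthickening s (closedBall c r)) <
      μ (closedBall c r ∩ A) := nhdsWithin_le_nhds (hlim'.eventually_lt_const h)
  obtain ⟨s, hs, hs0⟩ := (hev.and self_mem_nhdsWithin).exists
  have hs0 : 0 < s := hs0
  rw [cthickening_closedBall hs0.le hr.le] at hs
  have hx' : dist x c ≤ r := hx
  refine ⟨s + r, by positivity, by rw [mem_ball]; linarith, hs.trans_le (measure_mono ?_)⟩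
  gcongr
  linarith

variable [SecondCountableTopology E]

/-- Points close to balls of a fixed radius inside `S` carry at most a multiple of the mass of `S`,
by the Vitali covering lemma. -/
theorem measure_thickening_centers_le
    (hD : ∀ z r, 0 < r → μ (closedBall z (2 * r)) ≤ D * μ (closedBall z r))
    (S : Set E) {ρ : ℝ} (hρ : 0 < ρ) :
    μ (thickening (3 * ρ) {z | closedBall z (ρ / 2) ⊆ S}) ≤ D ^ 4 * μ S := by
  obtain ⟨u, hu, hdisj, hcov⟩ := Vitali.exists_disjoint_subfamily_covering_enlargement_closedBall
    {z | closedBall z (ρ / 2) ⊆ S} id (fun _ => ρ / 2) (ρ / 2) (fun _ _ => le_rfl) 5 (by norm_num)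
  have hcount : u.Countable := hdisj.countable_of_nonempty_interior fun z _ =>
    ⟨z, ball_subset_interior_closedBall (mem_ball_self (by positivity))⟩
  have hsub : thickening (3 * ρ) {z | closedBall z (ρ / 2) ⊆ S} ⊆
      ⋃ z ∈ u, closedBall z (2 ^ 4 * (ρ / 2)) := by
    intro x hx
    obtain ⟨z, hz, hxz⟩ := mem_thickening_iff.1 hx
    obtain ⟨b, hb, hzb⟩ := hcov z hz
    have : dist z b ≤ 5 * (ρ / 2) := hzb (mem_closedBall_self (by positivity))
    refine mem_biUnion hb ?_
    have := dist_triangle x z b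
    rw [mem_closedBall]
    linarith
  calc μ (thickening (3 * ρ) {z | closedBall z (ρ / 2) ⊆ S})
      ≤ μ (⋃ z ∈ u, closedBall z (2 ^ 4 * (ρ / 2))) := measure_mono hsub
    _ ≤ ∑' z : u, μ (closedBall (z : E) (2 ^ 4 * (ρ / 2))) := measure_biUnion_le μ hcount _
    _ ≤ ∑' z : u, D ^ 4 * μ (closedBall (z : E) (ρ / 2)) :=
        ENNReal.tsum_le_tsum fun z => measure_closedBall_two_pow_mul_le hD _ (by positivity) 4
    _ = D ^ 4 * μ (⋃ z ∈ u, closedBall z (ρ / 2)) := by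
        rw [ENNReal.tsum_mul_left]
        exact congrArg _ (measure_biUnion hcount hdisj fun _ _ => measurableSet_closedBall).symm
    _ ≤ D ^ 4 * μ S := by
        gcongr
        exact iUnion₂_subset fun z hz => hu hz

variable [NormedSpace ℝ E]

/-- The halo at a much smaller scale lies near `N` disjoint distance layers, each of comparable
mass. -/
theorem natCast_mul_measure_ballHalo_le
    (hD : ∀ z r, 0 < r → μ (closedBall z (2 * r)) ≤ D * μ (closedBall z r))
    {J : Set (E × ℝ)} (hJ : ∀ p ∈ J, 0 < p.2) {t : ℝ} (ht : 0 < t) (ht1 : t ≤ 1) (N : ℕ) :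
    N * μ (ballHalo J (t / (4 * 8 ^ N))) ≤ D ^ 4 * μ (ballHalo J t ∩ ballUnion J) := by
  set G := ballHalo J t ∩ ballUnion J with hG
  let h : ℤ → Set E := fun m =>
    thickening (3 * 8 ^ m) {z | closedBall z (8 ^ m / 2) ⊆ distLayer (ballUnion J) m ∩ G}
  have hmeas : ∀ m, MeasurableSet (h m) := fun m => isOpen_thickening.measurableSet
  have hcount : ∀ x ∈ ballHalo J (t / (4 * 8 ^ N)),
      (N : ℝ≥0∞) ≤ ∑' m, (h m).indicator 1 x := by
    rintro x ⟨p, hp, q, hq, v, hv, hxq, hxv⟩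
    have hp0 := hJ p hp
    obtain ⟨k, hk1, hk2⟩ := exists_mem_Ioc_zpow
      (show 0 < t / (4 * 8 ^ N) * p.2 by positivity) (show (1 : ℝ) < 8 by norm_num)
    have hmem : ∀ i ∈ Finset.range N, (h (k + 1 + i)).indicator (1 : E → ℝ≥0∞) x = 1 := by
      intro i hi
      refine indicator_of_mem (mem_thickening_of_mem_ballHalo ht1 hp hp0 hq hv hxq hxv ?_ ?_) _
      · exact hk2.trans (zpow_le_zpow_right₀ (by norm_num) (by omega))
      · have hi' := Finset.mem_range.1 hi
        calc (8 : ℝ) ^ (k + 1 + i) ≤ 8 ^ (k + N) :=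
              zpow_le_zpow_right₀ (by norm_num) (by omega)
          _ = 8 ^ k * 8 ^ N := by rw [zpow_add₀ (by norm_num), zpow_natCast]
          _ ≤ t / (4 * 8 ^ N) * p.2 * 8 ^ N := by gcongr
          _ = t * p.2 / 4 := by field_simp
    have hinj : Function.Injective fun i : ℕ => k + 1 + (i : ℤ) := fun a b hab => by
      simpa using hab
    calc (N : ℝ≥0∞) = ∑ i ∈ Finset.range N, (h (k + 1 + i)).indicator (1 : E → ℝ≥0∞) x := by
          rw [Finset.sum_congr rfl hmem]
          simp
      _ ≤ ∑' i : ℕ, (h (k + 1 + i)).indicator (1 : E → ℝ≥0∞) x := ENNReal.sum_le_tsum _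
      _ ≤ ∑' m, (h m).indicator 1 x :=
          ENNReal.tsum_comp_le_tsum_of_injective hinj fun m => (h m).indicator (1 : E → ℝ≥0∞) x
  have hind : ∀ m, Measurable ((h m).indicator (1 : E → ℝ≥0∞)) := fun m =>
    measurable_one.indicator (hmeas m)
  calc (N : ℝ≥0∞) * μ (ballHalo J (t / (4 * 8 ^ N)))
      ≤ N * μ {x | (N : ℝ≥0∞) ≤ ∑' m, (h m).indicator 1 x} := by
        gcongr
        exact hcount
    _ ≤ ∫⁻ x, ∑' m, (h m).indicator 1 x ∂μ :=
        mul_meas_ge_le_lintegral (Measurable.tsum hind) _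
    _ = ∑' m, μ (h m) := by
        rw [lintegral_tsum fun m => (hind m).aemeasurable]
        simp_rw [lintegral_indicator_one (hmeas _)]
    _ ≤ ∑' m, D ^ 4 * μ.restrict G (distLayer (ballUnion J) m) := by
        refine ENNReal.tsum_le_tsum fun m => ?_
        rw [Measure.restrict_apply (measurableSet_distLayer _ _)]
        exact measure_thickening_centers_le hD _ (by positivity)
    _ = D ^ 4 * μ.restrict G (⋃ m, distLayer (ballUnion J) m) := by
        rw [ENNReal.tsum_mul_left, measure_iUnion (pairwise_disjoint_distLayer _)
          (measurableSet_distLayer _)]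
    _ ≤ D ^ 4 * μ G := by
        rw [← Measure.restrict_apply_univ G]
        gcongr
        exact subset_univ _

/-- For a doubling measure, the mass of the halo decays geometrically in the number of scales. -/
theorem measure_ballHalo_le
    (hD : ∀ z r, 0 < r → μ (closedBall z (2 * r)) ≤ D * μ (closedBall z r))
    (hD0 : D ≠ 0) {N : ℕ} (hN : 2 * D ^ 4 ≤ N) {J : Set (E × ℝ)} (hJ : ∀ p ∈ J, 0 < p.2) (k : ℕ) :
    2 ^ k * μ (ballHalo J ((4 * 8 ^ N : ℝ)⁻¹ ^ (k + 1))) ≤ μ (ballUnion J) := by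
  have step : ∀ t : ℝ, 0 < t → t ≤ 1 →
      2 * μ (ballHalo J (t / (4 * 8 ^ N))) ≤ μ (ballHalo J t ∩ ballUnion J) := by
    intro t ht ht1
    have h := natCast_mul_measure_ballHalo_le hD hJ ht ht1 N
    have hN' : (2 : ℝ≥0∞) * D ^ 4 ≤ N := by exact_mod_cast hN
    have h4 : (D : ℝ≥0∞) ^ 4 ≠ 0 := by simpa using hD0
    refine (ENNReal.mul_le_mul_iff_right h4 (by simp)).1 ?_
    calc (D : ℝ≥0∞) ^ 4 * (2 * μ (ballHalo J (t / (4 * 8 ^ N))))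
        = 2 * D ^ 4 * μ (ballHalo J (t / (4 * 8 ^ N))) := by ring
      _ ≤ N * μ (ballHalo J (t / (4 * 8 ^ N))) := by gcongr
      _ ≤ _ := h
  have hK : (1 : ℝ) ≤ 4 * 8 ^ N := by
    have : (1 : ℝ) ≤ 8 ^ N := one_le_pow₀ (by norm_num)
    linarith
  have hdiv : ∀ k : ℕ, (4 * 8 ^ N : ℝ)⁻¹ ^ (k + 1) = (4 * 8 ^ N : ℝ)⁻¹ ^ k / (4 * 8 ^ N) :=
    fun k => by rw [pow_succ, div_eq_mul_inv]
  have hle1 : ∀ k : ℕ, (4 * 8 ^ N : ℝ)⁻¹ ^ k ≤ 1 := fun k =>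
    pow_le_one₀ (by positivity) (inv_le_one_of_one_le₀ hK)
  induction k with
  | zero =>
    have := step 1 one_pos le_rfl
    rw [hdiv]
    simp only [pow_zero, one_mul]
    calc μ (ballHalo J (1 / (4 * 8 ^ N))) ≤ 2 * μ (ballHalo J (1 / (4 * 8 ^ N))) :=
          le_mul_of_one_le_left' one_le_two
      _ ≤ _ := this
      _ ≤ μ (ballUnion J) := measure_mono inter_subset_right
  | succ k ih =>
    rw [hdiv, pow_succ, mul_assoc]
    refine le_trans ?_ ih
    gcongr
    exact (step _ (by positivity) (hle1 _)).trans (measure_mono inter_subset_left)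

/-- The Solyanik estimate for finite families of balls and a doubling measure. -/
theorem measure_ballUnion_le_of_finset
    (hD : ∀ z r, 0 < r → μ (closedBall z (2 * r)) ≤ D * μ (closedBall z r))
    (hfin : ∀ z r, 0 < r → μ (closedBall z r) < ⊤)
    (hD0 : D ≠ 0) {N : ℕ} (hN : 2 * D ^ 4 ≤ N) {k : ℕ} {δ : ℝ} (hδ0 : 0 < δ) (hδ1 : δ ≤ 1 / 2)
    (hδ : δ * ((D : ℝ) ^ (3 * N + 2)) ^ (k + 3) ≤ 1)
    {A : Set E} (hAfin : μ A < ⊤)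
    (J : Finset (E × ℝ)) (hJ : ∀ p ∈ J, 0 < p.2)
    (hJA : ∀ p ∈ J, μ (closedBall p.1 p.2 \ A) ≤ ENNReal.ofReal (δ ^ 2) * μ (closedBall p.1 p.2)) :
    μ (ballUnion (J : Set (E × ℝ))) ≤
      ENNReal.ofReal ((1 + (1 / 2) ^ k) * (1 + 2 * δ)) * μ A := by
  set ε : ℝ := (4 * 8 ^ N : ℝ)⁻¹ ^ (k + 2) with hε
  have hε0 : 0 ≤ ε := by positivity
  have hsmall : ∀ (c x : E) (r : ℝ), 0 < r → x ∈ closedBall c r → ∃ z, dist z x ≤ ε * r ∧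
      closedBall z (ε * r) ⊆ closedBall c r ∧
      ENNReal.ofReal δ * μ (closedBall c r) ≤ μ (closedBall z (ε * r)) := by
    intro c x r hr hx
    obtain ⟨z, h1, h2, h3⟩ := exists_closedBall_measure_ge hD N (k + 2) hr hx
    refine ⟨z, h1, h2, ?_⟩
    have hc : ENNReal.ofReal δ * ((D : ℝ≥0∞) ^ (3 * N + 2)) ^ (k + 3) ≤ 1 := by
      rw [← ENNReal.ofReal_coe_nnreal, ← ENNReal.ofReal_pow (by positivity),
        ← ENNReal.ofReal_pow (by positivity), ← ENNReal.ofReal_mul hδ0.le]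
      exact ENNReal.ofReal_le_one.2 hδ
    calc ENNReal.ofReal δ * μ (closedBall c r)
        ≤ ENNReal.ofReal δ * (((D : ℝ≥0∞) ^ (3 * N + 2)) ^ (k + 3) *
          μ (closedBall z (ε * r))) := by
          gcongr
      _ = ENNReal.ofReal δ * ((D : ℝ≥0∞) ^ (3 * N + 2)) ^ (k + 3) * μ (closedBall z (ε * r)) := by
          ring
      _ ≤ 1 * μ (closedBall z (ε * r)) := by gcongr
      _ = _ := one_mul _
  obtain ⟨S, hSJ, hsum, hcov⟩ := exists_subfamily_small_overlap hε0 hsmall J hJ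
  set U := ballUnion (S : Set (E × ℝ)) with hU
  have hUfin : μ U < ⊤ := (measure_biUnion_lt_top S.finite_toSet fun p hp =>
    hfin p.1 p.2 (hJ p (hSJ hp)))
  have hdiff : μ (U \ A) ≤ ENNReal.ofReal δ * μ U := by
    calc μ (U \ A) ≤ μ (⋃ p ∈ S, closedBall p.1 p.2 \ A) := by
          refine measure_mono fun x hx => ?_
          obtain ⟨p, hp, hxp⟩ := mem_iUnion₂.1 hx.1
          exact mem_biUnion hp ⟨hxp, hx.2⟩
      _ ≤ ∑ p ∈ S, μ (closedBall p.1 p.2 \ A) := measure_biUnion_finset_le _ _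
      _ ≤ ∑ p ∈ S, ENNReal.ofReal (δ ^ 2) * μ (closedBall p.1 p.2) :=
          Finset.sum_le_sum fun p hp => hJA p (hSJ hp)
      _ = ENNReal.ofReal δ * (ENNReal.ofReal δ * ∑ p ∈ S, μ (closedBall p.1 p.2)) := by
          rw [← Finset.mul_sum, sq, ENNReal.ofReal_mul hδ0.le, mul_assoc]
      _ ≤ ENNReal.ofReal δ * μ U := by gcongr
  have hUA : μ U ≤ μ A + ENNReal.ofReal δ * μ U :=
    calc μ U ≤ μ (A ∪ (U \ A)) := measure_mono (by simp)
      _ ≤ μ A + μ (U \ A) := measure_union_le _ _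
      _ ≤ _ := by gcongr
  have hhalo : μ (ballUnion (J : Set (E × ℝ))) ≤ μ U + ENNReal.ofReal ((1 / 2) ^ k) * μ U := by
    have hsub : ballUnion (J : Set (E × ℝ)) ⊆
        U ∪ ballHalo (S : Set (E × ℝ)) ((4 * 8 ^ N : ℝ)⁻¹ ^ (k + 1)) := by
      intro x hx
      by_cases hxU : x ∈ U
      · exact Or.inl hxU
      obtain ⟨p, hp, hxp⟩ := mem_iUnion₂.1 hx
      obtain ⟨i, hi, q, hq, hxq⟩ := hcov p hp x hxp
      have hi0 := hJ i (hSJ hi)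
      refine Or.inr ⟨i, hi, q, hq, x, hxU, hxq.trans ?_, by rw [dist_self]; positivity⟩
      gcongr
      rw [hε, pow_succ _ (k + 1), mul_left_comm]
      refine mul_le_of_le_one_right (by positivity) ?_
      have : (1 : ℝ) ≤ 8 ^ N := one_le_pow₀ (by norm_num)
      rw [← div_eq_mul_inv, div_le_one (by positivity)]
      linarith
    have h2 := measure_ballHalo_le hD hD0 hN (J := (S : Set (E × ℝ)))
      (fun p hp => hJ p (hSJ hp)) k
    refine (measure_mono hsub).trans ((measure_union_le _ _).trans ?_)
    gcongr
    rw [one_div, ENNReal.ofReal_pow (by positivity), ENNReal.ofReal_inv_of_pos two_pos,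
      ENNReal.ofReal_ofNat, ← ENNReal.inv_pow]
    rw [mul_comm (_⁻¹), ← div_eq_mul_inv, ENNReal.le_div_iff_mul_le (by simp) (by simp), mul_comm]
    exact h2
  have hreal : (μ U).toReal ≤ (1 + 2 * δ) * (μ A).toReal := by
    have h := ENNReal.toReal_mono (by finiteness) hUA
    rw [ENNReal.toReal_add hAfin.ne (by finiteness), ENNReal.toReal_mul,
      ENNReal.toReal_ofReal hδ0.le] at h
    have hA0 : 0 ≤ (μ A).toReal := ENNReal.toReal_nonneg
    have h5 : (1 - δ) * (μ U).toReal ≤ (1 - δ) * ((1 + 2 * δ) * (μ A).toReal) := by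
      nlinarith [mul_nonneg hA0 (mul_nonneg hδ0.le (by linarith : (0 : ℝ) ≤ 1 - 2 * δ))]
    exact le_of_mul_le_mul_left h5 (by linarith)
  have hUA' : μ U ≤ ENNReal.ofReal (1 + 2 * δ) * μ A := by
    rw [← ENNReal.ofReal_toReal hUfin.ne, ← ENNReal.ofReal_toReal hAfin.ne,
      ← ENNReal.ofReal_mul (by positivity)]
    exact ENNReal.ofReal_le_ofReal hreal
  calc μ (ballUnion (J : Set (E × ℝ))) ≤ μ U + ENNReal.ofReal ((1 / 2) ^ k) * μ U := hhalo
    _ = ENNReal.ofReal (1 + (1 / 2) ^ k) * μ U := by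
        rw [ENNReal.ofReal_add zero_le_one (by positivity), ENNReal.ofReal_one, add_mul, one_mul]
    _ ≤ ENNReal.ofReal (1 + (1 / 2) ^ k) * (ENNReal.ofReal (1 + 2 * δ) * μ A) := by gcongr
    _ = _ := by rw [← mul_assoc, ← ENNReal.ofReal_mul (by positivity)]

variable [FiniteDimensional ℝ E]

/-- The Solyanik estimate for the uncentered maximal operator with respect to a doubling
measure. -/
theorem solyanik_estimate_of_doubling
    (hD : ∀ z r, 0 < r → μ (closedBall z (2 * r)) ≤ D * μ (closedBall z r))
    (hfin : ∀ z r, 0 < r → μ (closedBall z r) < ⊤) (hD2 : 2 ≤ D) :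
    ∃ C cc α₀ : ℝ, 0 < C ∧ 0 < cc ∧ 0 < α₀ ∧ α₀ < 1 ∧
      ∀ α : ℝ, α₀ < α → α < 1 → ∀ A : Set E, MeasurableSet A → μ A < ⊤ →
        μ {x | ∃ (c : E) (r : ℝ), 0 < r ∧ x ∈ closedBall c r ∧
          ENNReal.ofReal α * μ (closedBall c r) < μ (closedBall c r ∩ A)} ≤
            (1 + ENNReal.ofReal (C * (1 - α) ^ cc)) * μ A := by
  obtain ⟨N, hN⟩ := exists_nat_ge (2 * D ^ 4)
  set P : ℝ := (D : ℝ) ^ (3 * N + 2) with hP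
  have hD2' : (2 : ℝ) ≤ D := by exact_mod_cast hD2
  have hP2 : 2 ≤ P := hD2'.trans (le_self_pow₀ (by linarith) (by omega))
  set c := Real.logb P 2 with hc
  have hc0 : 0 < c := Real.logb_pos (by linarith) (by norm_num)
  have hPc : P ^ c = 2 := Real.rpow_logb (by linarith) (by linarith) (by norm_num)
  have hc1 : c ≤ 1 := by
    rw [hc, Real.logb_le_iff_le_rpow (by linarith) (by norm_num), Real.rpow_one]
    exact hP2
  have hP6 : (P⁻¹) ^ 6 < 1 := pow_lt_one₀ (by positivity)
    (inv_lt_one_of_one_lt₀ (by linarith)) (by norm_num)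
  refine ⟨50, c / 2, 1 - P⁻¹ ^ 6, by norm_num, by positivity, by linarith,
    by linarith [show 0 < P⁻¹ ^ 6 by positivity], fun α hα hα1 A hA hAfin => ?_⟩
  set δ := √(1 - α) with hδ
  have hδ0 : 0 < δ := Real.sqrt_pos.2 (by linarith)
  have hδsq : δ ^ 2 = 1 - α := Real.sq_sqrt (by linarith)
  have hδP : δ * P ^ 3 ≤ 1 := by
    have h1 : δ ≤ P⁻¹ ^ 3 := by
      refine Real.sqrt_le_iff.2 ⟨by positivity, ?_⟩
      rw [← pow_mul]
      linarith
    calc δ * P ^ 3 ≤ P⁻¹ ^ 3 * P ^ 3 := by gcongr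
      _ = 1 := by field_simp
  have hδ2 : δ ≤ 1 / 2 := by
    have : (2 : ℝ) ^ 3 ≤ P ^ 3 := by gcongr
    nlinarith
  obtain ⟨k, hk1, hk2⟩ := exists_nat_pow_near_of_lt_one (x := δ * P ^ 3) (y := P⁻¹)
    (by positivity) hδP (by positivity) (inv_lt_one_of_one_lt₀ (by linarith))
  have hkδ : δ * P ^ (k + 3) ≤ 1 := by
    calc δ * P ^ (k + 3) = δ * P ^ 3 * P ^ k := by ring
      _ ≤ P⁻¹ ^ k * P ^ k := by gcongr
      _ = 1 := by rw [← mul_pow, inv_mul_cancel₀ (by positivity), one_pow]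
  have hhalf : (1 / 2 : ℝ) ^ k ≤ 16 * δ ^ c := by
    have h := Real.rpow_le_rpow (by positivity) hk1.le hc0.le
    rw [Real.mul_rpow hδ0.le (by positivity), ← Real.rpow_pow_comm (by positivity),
      ← Real.rpow_pow_comm (by positivity), Real.inv_rpow (by positivity), hPc, pow_succ] at h
    rw [one_div]
    linarith
  have hδc : δ ≤ δ ^ c := by
    simpa using Real.rpow_le_rpow_of_exponent_ge hδ0 (by linarith) hc1
  have hδc1 : δ ^ c ≤ 1 := Real.rpow_le_one hδ0.le (by linarith) hc0.le
  have hrpow : (1 - α) ^ (c / 2) = δ ^ c := by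
    rw [hδ, Real.sqrt_eq_rpow, ← Real.rpow_mul (by linarith)]
    congr 1
    ring
  have hconst : (1 + (1 / 2) ^ k) * (1 + 2 * δ) ≤ 1 + 50 * (1 - α) ^ (c / 2) := by
    rw [hrpow]
    calc (1 + (1 / 2 : ℝ) ^ k) * (1 + 2 * δ) ≤ (1 + 16 * δ ^ c) * (1 + 2 * δ ^ c) := by gcongr
      _ ≤ 1 + 50 * δ ^ c := by nlinarith [Real.rpow_nonneg hδ0.le c]
  have hα0 : 0 ≤ α := by linarith
  have hcompl : ∀ (z : E) (r : ℝ), 0 < r →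
      ENNReal.ofReal α * μ (closedBall z r) < μ (closedBall z r ∩ A) →
      μ (closedBall z r \ A) ≤ ENNReal.ofReal (δ ^ 2) * μ (closedBall z r) := by
    intro z r hr h
    have hQ := hfin z r hr
    have hadd := measure_inter_add_sdiff (μ := μ) (closedBall z r) hA
    refine (ENNReal.add_le_add_iff_left
      (a := ENNReal.ofReal α * μ (closedBall z r)) (by finiteness)).1 ?_
    rw [← add_mul, ← ENNReal.ofReal_add hα0 (by positivity), hδsq, add_sub_cancel,
      ENNReal.ofReal_one, one_mul]
    calc _ ≤ μ (closedBall z r ∩ A) + μ (closedBall z r \ A) := by gcongr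
      _ = _ := hadd
  have : IsFiniteMeasureOnCompacts μ := ⟨fun K hK => by
    obtain ⟨r, hr⟩ := hK.isBounded.subset_closedBall (0 : E)
    exact (measure_mono (hr.trans (closedBall_subset_closedBall (le_max_left r 1)))).trans_lt
      (hfin _ _ (lt_max_of_lt_right one_pos))⟩
  let I : Set (E × ℝ) := {p | 0 < p.2 ∧
    ENNReal.ofReal α * μ (closedBall p.1 p.2) < μ (closedBall p.1 p.2 ∩ A)}
  have hopen : IsOpen (⋃ p ∈ I, ball p.1 p.2) := isOpen_biUnion fun _ _ => isOpen_ball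
  calc μ {x | ∃ (c : E) (r : ℝ), 0 < r ∧ x ∈ closedBall c r ∧
          ENNReal.ofReal α * μ (closedBall c r) < μ (closedBall c r ∩ A)}
      ≤ μ (⋃ p ∈ I, ball p.1 p.2) := by
        refine measure_mono ?_
        rintro x ⟨z, r, hr, hx, h⟩
        obtain ⟨r', hr', hx', h'⟩ := exists_mem_ball_of_mem_closedBall hfin hr hx h
        exact mem_biUnion (show (z, r') ∈ I from ⟨hr', h'⟩) hx'
    _ ≤ ENNReal.ofReal ((1 + (1 / 2) ^ k) * (1 + 2 * δ)) * μ A := by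
        rw [hopen.measure_eq_iSup_isCompact]
        refine iSup₂_le fun K hK => iSup_le fun hKc => ?_
        obtain ⟨J, hJI, hJfin, hJ⟩ := hKc.elim_finite_subcover_image
          (fun p (_ : p ∈ I) => isOpen_ball) hK
        lift J to Finset (E × ℝ) using hJfin
        refine le_trans (measure_mono (hJ.trans ?_)) (measure_ballUnion_le_of_finset hD hfin
          (by positivity) hN hδ0 hδ2 hkδ hAfin J (fun p hp => (hJI hp).1)
          fun p hp => hcompl p.1 p.2 (hJI hp).1 (hJI hp).2)
        exact biUnion_mono subset_rfl fun p _ => ball_subset_closedBall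
    _ ≤ (1 + ENNReal.ofReal (50 * (1 - α) ^ (c / 2))) * μ A := by
        gcongr
        rw [← ENNReal.ofReal_one, ← ENNReal.ofReal_add zero_le_one
          (mul_nonneg (by norm_num) (Real.rpow_nonneg (by linarith) _))]
        exact ENNReal.ofReal_le_ofReal hconst

end Doubling

section FujiiWilson

variable {n : ℕ}

/-- The points of the ball `closedBall c R` at distance about `ρ` from its boundary. -/
def shellLayer (c : Fin n → ℝ) (R ρ : ℝ) : Set (Fin n → ℝ) :=
  {x | ρ ≤ R - dist x c ∧ R - dist x c < 5 * ρ}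

theorem measurableSet_shellLayer (c : Fin n → ℝ) (R ρ : ℝ) :
    MeasurableSet (shellLayer c R ρ) := by
  have h : Measurable fun x : Fin n → ℝ => R - dist x c := by fun_prop
  exact (measurableSet_le measurable_const h).inter (measurableSet_lt h measurable_const)

theorem shellLayer_subset_closedBall (c : Fin n → ℝ) (R : ℝ) {ρ : ℝ} (hρ : 0 ≤ ρ) :
    shellLayer c R ρ ⊆ closedBall c R := fun x hx => by
  rw [mem_closedBall]
  linarith [hx.1]

theorem exists_closedBall_subset_shellLayer {c y : Fin n → ℝ} {R ρ : ℝ} (hρ : 0 < ρ)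
    (hρR : 2 * ρ ≤ R) (hy : y ∈ closedBall c R) (hyρ : R - dist y c ≤ ρ) :
    ∃ z, closedBall z ρ ⊆ shellLayer c R ρ ∩ closedBall y (3 * ρ) := by
  have hR : 0 < R := by linarith
  have hy' : dist y c ≤ R := hy
  have h0 : 0 ≤ 2 * ρ / R := by positivity
  have h1 : 2 * ρ / R ≤ 1 := (div_le_one hR).2 hρR
  have hs : 2 * ρ / R * dist y c ≤ 2 * ρ := by
    calc 2 * ρ / R * dist y c ≤ 2 * ρ / R * R := by gcongr
      _ = 2 * ρ := by field_simp
  have hs' : (1 - 2 * ρ / R) * dist y c ≤ R - 2 * ρ := by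
    calc (1 - 2 * ρ / R) * dist y c ≤ (1 - 2 * ρ / R) * R := by gcongr
      _ = R - 2 * ρ := by field_simp
  have hzy := dist_lineMap_left (𝕜 := ℝ) y c (2 * ρ / R)
  have hzc := dist_lineMap_right (𝕜 := ℝ) y c (2 * ρ / R)
  rw [Real.norm_of_nonneg h0] at hzy
  rw [Real.norm_of_nonneg (by linarith)] at hzc
  refine ⟨AffineMap.lineMap y c (2 * ρ / R), fun x hx => ?_⟩
  set z : Fin n → ℝ := AffineMap.lineMap y c (2 * ρ / R)
  have hxz : dist x z ≤ ρ := hx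
  have h3 := dist_triangle x z c
  have h4 := dist_triangle z x c
  rw [dist_comm z x] at h4
  have h5 := dist_triangle x z y
  refine ⟨⟨?_, ?_⟩, ?_⟩
  · linarith
  · linarith
  · rw [mem_closedBall]
    linarith

variable {w : (Fin n → ℝ) → ℝ≥0∞}

theorem weightMeasure_inter_closedBall_le (c x : Fin n → ℝ) (R : ℝ) {r : ℝ}
    (hr : 0 < r) :
    weightMeasure n w (closedBall c R ∩ closedBall x r) ≤
      volume (closedBall x r) * maxOp n ((closedBall c R).indicator w) x := by
  have hV0 : volume (closedBall x r) ≠ 0 := (measure_closedBall_pos _ _ hr).ne'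
  have hVtop : volume (closedBall x r) ≠ ⊤ := measure_closedBall_lt_top.ne
  have hM : (∫⁻ y in closedBall x r, (closedBall c R).indicator w y) / volume (closedBall x r) ≤
      maxOp n ((closedBall c R).indicator w) x :=
    le_iSup_of_le x (le_iSup_of_le r (le_iSup_of_le hr
      (le_iSup_of_le (mem_closedBall_self hr.le) le_rfl)))
  rw [ENNReal.div_le_iff_le_mul (Or.inl hV0) (Or.inl hVtop), mul_comm] at hM
  refine le_trans (le_of_eq ?_) hM
  rw [weightMeasure, withDensity_apply _ (measurableSet_closedBall.inter measurableSet_closedBall),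
    lintegral_indicator measurableSet_closedBall, Measure.restrict_restrict measurableSet_closedBall]

/-- The mass of a thin shell is controlled by the integral of the maximal function over any layer
of larger depth. -/
theorem weightMeasure_shell_le {c : Fin n → ℝ} {R ρ s : ℝ} (hρ : 0 < ρ)
    (hρR : 2 * ρ ≤ R) (hs : s ≤ ρ) :
    weightMeasure n w (closedBall c R \ ball c (R - s)) ≤
      3 ^ n * ∫⁻ x in shellLayer c R ρ, maxOp n ((closedBall c R).indicator w) x := by
  set F := closedBall c R \ ball c (R - s) with hF
  set L := shellLayer c R ρ with hL
  have hFmeas : MeasurableSet F := measurableSet_closedBall.diff measurableSet_ball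
  set v : ℝ≥0∞ := ENNReal.ofReal ((2 * ρ) ^ n) with hv
  have hv0 : v ≠ 0 := (ENNReal.ofReal_pos.2 (by positivity)).ne'
  have hvol : ∀ z : Fin n → ℝ, volume (closedBall z ρ) = v := fun z => by
    rw [Real.volume_pi_closedBall _ hρ.le, Fintype.card_fin]
  have hvol3 : ∀ z : Fin n → ℝ, volume (closedBall z (3 * ρ)) = 3 ^ n * v := fun z => by
    rw [Real.volume_pi_closedBall _ (by positivity), Fintype.card_fin,
      show 2 * (3 * ρ) = 3 * (2 * ρ) by ring, mul_pow, ENNReal.ofReal_mul (by positivity),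
      ENNReal.ofReal_pow (by positivity), ENNReal.ofReal_ofNat]
  have : SFinite (weightMeasure n w) := by
    unfold weightMeasure
    infer_instance
  have hswap : ∫⁻ x in L, ∫⁻ y in F, (closedBall x (3 * ρ)).indicator 1 y ∂weightMeasure n w =
      ∫⁻ y in F, ∫⁻ x in L, (closedBall x (3 * ρ)).indicator 1 y ∂volume ∂weightMeasure n w := by
    refine lintegral_lintegral_swap (Measurable.aemeasurable ?_)
    have hset : MeasurableSet {p : (Fin n → ℝ) × (Fin n → ℝ) | dist p.2 p.1 ≤ 3 * ρ} :=
      measurableSet_le (by fun_prop) measurable_const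
    exact (measurable_const (a := (1 : ℝ≥0∞))).indicator hset
  have hlower : ∀ y ∈ F, v ≤
      ∫⁻ x in L, (closedBall x (3 * ρ)).indicator (1 : (Fin n → ℝ) → ℝ≥0∞) y := by
    intro y hy
    have hyR : R - s ≤ dist y c := not_lt.1 hy.2
    obtain ⟨z, hz⟩ := exists_closedBall_subset_shellLayer hρ hρR hy.1 (by linarith)
    have heq : (fun x => (closedBall x (3 * ρ)).indicator (1 : (Fin n → ℝ) → ℝ≥0∞) y) =
        (closedBall y (3 * ρ)).indicator 1 := by
      ext x
      simp only [indicator, mem_closedBall, dist_comm, Pi.one_apply]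
    rw [heq, lintegral_indicator_one measurableSet_closedBall,
      Measure.restrict_apply measurableSet_closedBall, ← hvol z, inter_comm]
    exact measure_mono hz
  have hmain : v * weightMeasure n w F ≤
      v * (3 ^ n * ∫⁻ x in L, maxOp n ((closedBall c R).indicator w) x) := by
    calc v * weightMeasure n w F = ∫⁻ y in F, v ∂weightMeasure n w := by
          rw [setLIntegral_const]
      _ ≤ ∫⁻ y in F, ∫⁻ x in L, (closedBall x (3 * ρ)).indicator 1 y ∂volume ∂weightMeasure n w :=
          setLIntegral_mono' hFmeas hlower
      _ = ∫⁻ x in L, ∫⁻ y in F, (closedBall x (3 * ρ)).indicator 1 y ∂weightMeasure n w :=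
          hswap.symm
      _ ≤ ∫⁻ x in L, 3 ^ n * v * maxOp n ((closedBall c R).indicator w) x := by
          refine lintegral_mono fun x => ?_
          rw [lintegral_indicator_one measurableSet_closedBall,
            Measure.restrict_apply measurableSet_closedBall, ← hvol3 x, inter_comm]
          exact (measure_mono (inter_subset_inter_left _ sdiff_subset)).trans
            (weightMeasure_inter_closedBall_le c x R (by positivity))
      _ = v * (3 ^ n * ∫⁻ x in L, maxOp n ((closedBall c R).indicator w) x) := by
          rw [lintegral_const_mul' _ _ (ENNReal.mul_ne_top (by simp) ENNReal.ofReal_ne_top)]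
          ring
  exact (ENNReal.mul_le_mul_iff_right hv0 ENNReal.ofReal_ne_top).1 hmain

theorem natCast_mul_weightMeasure_shell_le (c : Fin n → ℝ) {R : ℝ} (hR : 0 < R)
    (N : ℕ) :
    N * weightMeasure n w (closedBall c R \ ball c (R - R / 8 ^ N)) ≤
      3 ^ n * ∫⁻ x in closedBall c R, maxOp n ((closedBall c R).indicator w) x := by
  have hdisj : ((Finset.Icc 1 N : Finset ℕ) : Set ℕ).PairwiseDisjoint
      fun m => shellLayer c R (R / 8 ^ m) := by
    have key : ∀ m k : ℕ, m < k →
        Disjoint (shellLayer c R (R / 8 ^ m)) (shellLayer c R (R / 8 ^ k)) := by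
      intro m k hmk
      refine Set.disjoint_left.2 fun x hx hx' => ?_
      have h1 : R / 8 ^ k ≤ R / 8 ^ (m + 1) := by
        gcongr
        · norm_num
        · omega
      have h2 : R / 8 ^ (m + 1) = R / 8 ^ m / 8 := by
        rw [pow_succ, div_div]
      have h3 : 0 < R / 8 ^ m := by positivity
      linarith [hx.1, hx'.2]
    intro m _ k _ hmk
    rcases lt_or_gt_of_ne hmk with h | h
    · exact key m k h
    · exact (key k m h).symm
  set f := maxOp n ((closedBall c R).indicator w)
  calc N * weightMeasure n w (closedBall c R \ ball c (R - R / 8 ^ N))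
      = ∑ m ∈ Finset.Icc 1 N, weightMeasure n w (closedBall c R \ ball c (R - R / 8 ^ N)) := by
        simp
    _ ≤ ∑ m ∈ Finset.Icc 1 N, 3 ^ n * ∫⁻ x in shellLayer c R (R / 8 ^ m), f x := by
        refine Finset.sum_le_sum fun m hm => ?_
        obtain ⟨hm1, hmN⟩ := Finset.mem_Icc.1 hm
        refine weightMeasure_shell_le (by positivity) ?_ ?_
        · have h8 : (8 : ℝ) ^ 1 ≤ 8 ^ m := pow_le_pow_right₀ (by norm_num) hm1
          rw [← mul_div_assoc, div_le_iff₀ (by positivity)]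
          nlinarith
        · gcongr
          norm_num
    _ = 3 ^ n * ∫⁻ x in ⋃ m ∈ Finset.Icc 1 N, shellLayer c R (R / 8 ^ m), f x := by
        rw [← Finset.mul_sum, lintegral_biUnion_finset hdisj fun m _ =>
          measurableSet_shellLayer _ _ _]
    _ ≤ 3 ^ n * ∫⁻ x in closedBall c R, f x := by
        gcongr
        exact iUnion₂_subset fun m _ => shellLayer_subset_closedBall c R (by positivity)

/-- A weight with finite Fujii–Wilson constant is doubling. -/
theorem exists_doubling_of_fujiiWilson
    (hfin : ∀ (c : Fin n → ℝ) (r : ℝ), 0 < r → weightMeasure n w (closedBall c r) < ⊤)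
    {A : ℝ≥0∞} (hA : A < ⊤)
    (hAinfty : ∀ (c : Fin n → ℝ) (r : ℝ), 0 < r →
      (∫⁻ x in closedBall c r, maxOp n ((closedBall c r).indicator w) x) ≤
        A * weightMeasure n w (closedBall c r)) :
    ∃ D : ℝ≥0, 2 ≤ D ∧ ∀ (c : Fin n → ℝ) (r : ℝ), 0 < r →
      weightMeasure n w (closedBall c (2 * r)) ≤ D * weightMeasure n w (closedBall c r) := by
  lift A to ℝ≥0 using hA.ne
  obtain ⟨N, hN⟩ := exists_nat_gt (2 * 3 ^ n * A)
  have hN0 : N ≠ 0 := by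
    rintro rfl
    simp at hN
  set θ : ℝ := 1 - 1 / 8 ^ N with hθ
  have h8 : (1 : ℝ) < 8 ^ N := one_lt_pow₀ (by norm_num) hN0
  have hθ1 : θ < 1 := by
    have : (0 : ℝ) < 1 / 8 ^ N := by positivity
    linarith
  have hθ0 : 0 < θ := by
    have : (1 : ℝ) / 8 ^ N < 1 := (div_lt_one (by positivity)).2 h8
    linarith
  have hstep : ∀ (c : Fin n → ℝ) (R : ℝ), 0 < R →
      weightMeasure n w (closedBall c R) ≤ 2 * weightMeasure n w (closedBall c (θ * R)) := by
    intro c R hR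
    set Q := weightMeasure n w (closedBall c R) with hQ
    set F := weightMeasure n w (closedBall c R \ ball c (R - R / 8 ^ N)) with hF
    have hFQ : 2 * F ≤ Q := by
      have h1 : (N : ℝ≥0∞) * F ≤ 3 ^ n * (A * Q) :=
        (natCast_mul_weightMeasure_shell_le c hR N).trans (by gcongr; exact hAinfty c R hR)
      have hN' : (2 : ℝ≥0∞) * 3 ^ n * A ≤ N := by exact_mod_cast hN.le
      refine (ENNReal.mul_le_mul_iff_right (a := (N : ℝ≥0∞)) (by simpa using hN0) (by simp)).1 ?_
      calc (N : ℝ≥0∞) * (2 * F) = 2 * (N * F) := by ring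
        _ ≤ 2 * (3 ^ n * (A * Q)) := by gcongr
        _ = 2 * 3 ^ n * A * Q := by ring
        _ ≤ N * Q := by gcongr
    have hsplit : Q ≤ weightMeasure n w (closedBall c (θ * R)) + F := by
      refine (measure_mono fun x hx => ?_).trans (measure_union_le _ _)
      by_cases hxb : x ∈ ball c (R - R / 8 ^ N)
      · left
        rw [show θ * R = R - R / 8 ^ N by rw [hθ]; ring]
        exact ball_subset_closedBall hxb
      · exact Or.inr ⟨hx, hxb⟩
    have hQfin : Q ≠ ⊤ := (hfin c R hR).ne
    refine (ENNReal.add_le_add_iff_left hQfin).1 ?_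
    calc Q + Q = 2 * Q := (two_mul Q).symm
      _ ≤ 2 * (weightMeasure n w (closedBall c (θ * R)) + F) := by gcongr
      _ = 2 * F + 2 * weightMeasure n w (closedBall c (θ * R)) := by ring
      _ ≤ Q + 2 * weightMeasure n w (closedBall c (θ * R)) := by gcongr
  have hiter : ∀ (M : ℕ) (c : Fin n → ℝ) (R : ℝ), 0 < R →
      weightMeasure n w (closedBall c R) ≤ 2 ^ M * weightMeasure n w (closedBall c (θ ^ M * R)) := by
    intro M c R hR
    induction M with
    | zero => simp
    | succ M ih =>
      calc weightMeasure n w (closedBall c R)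
          ≤ 2 ^ M * weightMeasure n w (closedBall c (θ ^ M * R)) := ih
        _ ≤ 2 ^ M * (2 * weightMeasure n w (closedBall c (θ * (θ ^ M * R)))) := by
            gcongr
            exact hstep c _ (by positivity)
        _ = 2 ^ (M + 1) * weightMeasure n w (closedBall c (θ ^ (M + 1) * R)) := by
            rw [pow_succ, pow_succ, mul_assoc, ← mul_assoc θ, mul_comm θ]
  obtain ⟨M, hM⟩ := exists_pow_lt_of_lt_one (show (0 : ℝ) < 1 / 2 by norm_num) hθ1
  refine ⟨2 ^ (M + 1), le_self_pow₀ one_le_two (by omega), fun c r hr => ?_⟩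
  push_cast
  refine (hiter M c (2 * r) (by positivity)).trans ?_
  gcongr
  · exact one_le_two
  · omega
  · nlinarith

end FujiiWilson

end

/-- Solyanik estimate for the maximal operator defined with respect to an A_∞ weight w:
if w ∈ A_∞ (finite Fujii–Wilson constant), then the sharp Tauberian constant of M_w
satisfies C_w(α) − 1 ≤ C_{w,n} (1−α)^{c_{w,n}} for α close to 1. -/
theorem solyanik_estimate_Ainfty_measure (n : ℕ) (w : (Fin n → ℝ) → ℝ≥0∞)
    (hw : Measurable w)
    (hfin : ∀ (c : Fin n → ℝ) (r : ℝ), 0 < r → weightMeasure n w (closedBall c r) < ⊤)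
    (hpos : ∀ (c : Fin n → ℝ) (r : ℝ), 0 < r → 0 < weightMeasure n w (closedBall c r))
    (hAinfty : ∃ A : ℝ≥0∞, A < ⊤ ∧ ∀ (c : Fin n → ℝ) (r : ℝ), 0 < r →
      (∫⁻ x in closedBall c r, maxOp n ((closedBall c r).indicator w) x) ≤
        A * weightMeasure n w (closedBall c r)) :
    ∃ C cc α₀ : ℝ, 0 < C ∧ 0 < cc ∧ 0 < α₀ ∧ α₀ < 1 ∧
      ∀ α : ℝ, α₀ < α → α < 1 →
        ∀ E : Set (Fin n → ℝ), MeasurableSet E →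
          0 < weightMeasure n w E → weightMeasure n w E < ⊤ →
          weightMeasure n w {x | ∃ (c : Fin n → ℝ) (r : ℝ), 0 < r ∧ x ∈ closedBall c r ∧
              ENNReal.ofReal α * weightMeasure n w (closedBall c r) <
                weightMeasure n w (closedBall c r ∩ E)} ≤
            (1 + ENNReal.ofReal (C * (1 - α) ^ cc)) * weightMeasure n w E := by
  obtain ⟨A, hA, hA'⟩ := hAinfty
  obtain ⟨D, hD2, hD⟩ := exists_doubling_of_fujiiWilson hfin hA hA'
  obtain ⟨C, cc, α₀, hC, hcc, hα₀, hα₀1, h⟩ := solyanik_estimate_of_doubling hD hfin hD2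
  exact ⟨C, cc, α₀, hC, hcc, hα₀, hα₀1, fun α hα hα1 E hE _ hEfin => h α hα hα1 E hE hEfin⟩
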